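/- Let Γ be a simple graph on a vertex type V that is locally finite and regular of degree q + 1, and let R be a commutative ring. A dart of Γ is an ordered pair of adjacent vertices; for a dart e write s(e) for its first vertex (source), t(e) for its second vertex (target), and ē for the reversed dart. For a function F from darts of Γ to R, define (U F)(e) = (∑_{w ∈ neighbors of t(e)} F(t(e), w)) − F(ē). Let φ₀ : V → R satisfy ∑_{w ∈ neighbors of v} φ₀(w) = a · φ₀(v) for every vertex v, and let α ∈ R satisfy α² = a·α − q (i.e. α is a root of x² − a·x + q). Define F on darts by F(e) = φ₀(s(e)) − α · φ₀(t(e)). Then U F = α · F, i.e. (U F)(e) = α · F(e) for every dart e. -/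

import Mathlib

/-- The "U_p" operator on functions on darts of a locally finite graph:
`(U F)(e) = (∑_{w ∈ neighbors of t(e)} F(t(e), w)) − F(ē)`. -/
def dartHeckeU {V R : Type*} [CommRing R] (G : SimpleGraph V) [G.LocallyFinite]
    (F : G.Dart → R) (e : G.Dart) : R :=
  (∑ w ∈ (G.neighborFinset e.toProd.2).attach,
      F ⟨(e.toProd.2, (w : V)), (G.mem_neighborFinset _ _).mp w.2⟩) - F e.symm

/-- Let `Γ` be locally finite and regular of degree `q + 1`, let `φ₀ : V → R` be an
eigenfunction of the adjacency operator with eigenvalue `a`, and let `α` satisfy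
`α² = a·α − q`.  Then `F(e) = φ₀(s(e)) − α·φ₀(t(e))` satisfies `U F = α · F`. -/
theorem dartHeckeU_stabilization_eigenvector (V R : Type*) [CommRing R]
    (G : SimpleGraph V) [G.LocallyFinite] (q : ℕ)
    (hreg : G.IsRegularOfDegree (q + 1)) (φ₀ : V → R) (a α : R)
    (heig : ∀ v : V, ∑ w ∈ G.neighborFinset v, φ₀ w = a * φ₀ v)
    (hα : α ^ 2 = a * α - (q : R)) (e : G.Dart) :
    dartHeckeU G (fun d => φ₀ d.toProd.1 - α * φ₀ d.toProd.2) e =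
      α * (φ₀ e.toProd.1 - α * φ₀ e.toProd.2) := by
  have hsum : ∑ w ∈ (G.neighborFinset e.toProd.2).attach,
      (φ₀ e.toProd.2 - α * φ₀ w) = (q + 1) * φ₀ e.toProd.2 - α * (a * φ₀ e.toProd.2) := by
    rw [Finset.sum_attach (G.neighborFinset e.toProd.2) fun w => φ₀ e.toProd.2 - α * φ₀ w,
      Finset.sum_sub_distrib, ← Finset.mul_sum, heig, Finset.sum_const,
      G.card_neighborFinset_eq_degree, hreg.degree_eq, nsmul_eq_mul]
    push_cast
    rfl
  simp only [dartHeckeU, hsum, SimpleGraph.Dart.symm_toProd, Prod.fst_swap, Prod.snd_swap]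
  linear_combination φ₀ e.toProd.2 * hα
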